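/- arXiv:2006.00247 — 4 statements merged into one kernel-verified Lean document; each statement's English description precedes it below -/
import Mathlib

section
/- Define K : [0, ∞) → ℝ by K(z) = ((2 − z²)/π) · arccos(z²/2 − 1) + (z/(2π)) · √(4 − z²) for 0 ≤ z ≤ 2 and K(z) = 0 for z > 2. Then the radial function obtained from K fails to be positive definite: there exist a dimension d ≥ 1, an integer n ≥ 1, points x₁, …, xₙ ∈ ℝ^d, and real coefficients c₁, …, cₙ such that ∑_{i=1}^n ∑_{j=1}^n cᵢ cⱼ K(‖xᵢ − xⱼ‖₂) < 0. -/
/-- The stationary NTK profile of a two-layer ReLU network on the unit sphere,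
extended by `0` beyond `z = 2`. -/
noncomputable def ntkProfile (z : ℝ) : ℝ :=
  if z ≤ 2 then
    ((2 - z ^ 2) / Real.pi) * Real.arccos (z ^ 2 / 2 - 1)
      + (z / (2 * Real.pi)) * Real.sqrt (4 - z ^ 2)
  else 0

theorem ntkProfile_zero : ntkProfile 0 = 2 := by
  have := Real.pi_ne_zero
  simp [ntkProfile]

theorem ntkProfile_sqrt_three : ntkProfile √3 = -(1 / 3) + √3 / (2 * Real.pi) := by
  have h3 : √(3 : ℝ) ^ 2 = 3 := Real.sq_sqrt (by norm_num)
  have hle : √(3 : ℝ) ≤ 2 := Real.sqrt_le_iff.mpr (by norm_num)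
  have harccos : Real.arccos (3 / 2 - 1) = Real.pi / 3 := by
    rw [show (3 / 2 - 1 : ℝ) = 1 / 2 by norm_num, ← Real.cos_pi_div_three]
    exact Real.arccos_cos (by positivity) (by linarith [Real.pi_pos])
  have hpi := Real.pi_ne_zero
  rw [ntkProfile, if_pos hle, h3, harccos, show (4 - 3 : ℝ) = 1 by norm_num, Real.sqrt_one]
  field_simp
  ring

theorem ntkProfile_sqrt_three_lt : ntkProfile √3 < -(1 / 20) := by
  have hs : √(3 : ℝ) < 1.74 := (Real.sqrt_lt' (by norm_num)).mpr (by norm_num)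
  have hpi := Real.pi_gt_d2
  have : √3 / (2 * Real.pi) < 1 / 3 - 1 / 20 := by
    rw [div_lt_iff₀ (by positivity)]
    linarith
  rw [ntkProfile_sqrt_three]
  linarith

theorem norm_single_sub_single {ι : Type*} [Fintype ι] [DecidableEq ι] {i j : ι} (hij : i ≠ j)
    (a : ℝ) :
    ‖EuclideanSpace.single i a - EuclideanSpace.single j a‖ = √(2 * a ^ 2) := by
  rw [eq_comm, Real.sqrt_eq_iff_mul_self_eq (by positivity) (norm_nonneg _),
    norm_sub_mul_self_real]
  simp [EuclideanSpace.inner_single_left, hij]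
  ring

/-- The radial function obtained from the stationary NTK profile `K` fails to
be positive definite. -/
theorem stmt_6 :
    ∃ (d n : ℕ) (_ : 1 ≤ d) (_ : 1 ≤ n)
      (x : Fin n → EuclideanSpace ℝ (Fin d)) (c : Fin n → ℝ),
      ∑ i, ∑ j, c i * c j * ntkProfile ‖x i - x j‖ < 0 := by
  -- The vertices of a regular simplex of side `√3`, where the profile is negative.
  refine ⟨100, 100, by norm_num, by norm_num,
    fun i => EuclideanSpace.single i √(3 / 2), fun _ => 1, ?_⟩
  have hterm (i j : Fin 100) :
      1 * 1 * ntkProfile ‖EuclideanSpace.single i √(3 / 2) - EuclideanSpace.single j √(3 / 2)‖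
        = (if i = j then 2 - ntkProfile √3 else 0) + ntkProfile √3 := by
    split_ifs with hij
    · simp [hij, ntkProfile_zero]
    · rw [norm_single_sub_single hij, Real.sq_sqrt (by norm_num)]
      norm_num
  simp only [hterm, Finset.sum_add_distrib, Finset.sum_ite_eq, Finset.mem_univ, if_true,
    Finset.sum_const, Finset.card_univ, Fintype.card_fin, nsmul_eq_mul]
  norm_num
  linarith [ntkProfile_sqrt_three_lt]
end

section
/- Define g : (0, 4) → ℝ by g(x) = ((2 − x)/π) · arccos(x/2 − 1) + (1/(2π)) · √(4x − x²). Then there exists x ∈ (0, 4) with g′(x) > 0; in particular, g is not completely monotone on (0, 4), i.e., it is not the case that (−1)^r g^{(r)}(x) ≥ 0 for all integers r ≥ 0 and all x ∈ (0, 4). -/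
/-- The function `g` with `g(z²) = K(z)` for the stationary NTK profile `K`. -/
noncomputable def ntkG (x : ℝ) : ℝ :=
  ((2 - x) / Real.pi) * Real.arccos (x / 2 - 1)
    + (1 / (2 * Real.pi)) * Real.sqrt (4 * x - x ^ 2)

/-- The derivative of `ntkG` at an interior point `x` of `(0, 4)`. -/
theorem hasDerivAt_ntkG {x : ℝ} (hx : x ∈ Set.Ioo (0 : ℝ) 4) :
    HasDerivAt ntkG
      ((x - 2) / (2 * Real.pi * Real.sqrt (4 * x - x ^ 2)) - Real.arccos (x / 2 - 1) / Real.pi)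
      x := by
  obtain ⟨h0, h4⟩ := hx
  have hpos : 0 < 4 * x - x ^ 2 := by nlinarith
  have hs : 0 < Real.sqrt (4 * x - x ^ 2) := Real.sqrt_pos.2 hpos
  have hroot : Real.sqrt (1 - (x / 2 - 1) ^ 2) = Real.sqrt (4 * x - x ^ 2) / 2 := by
    rw [show 1 - (x / 2 - 1) ^ 2 = (4 * x - x ^ 2) / 2 ^ 2 by ring, Real.sqrt_div hpos.le,
      Real.sqrt_sq (by norm_num)]
  have harccos := (Real.hasDerivAt_arccos (x := x / 2 - 1) (by linarith) (by linarith)).comp x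
    (((hasDerivAt_id x).div_const 2).sub_const 1)
  have hsqrt := (((hasDerivAt_id x).const_mul 4).sub ((hasDerivAt_id x).pow 2)).sqrt hpos.ne'
  have hlin := ((hasDerivAt_id x).const_sub 2).div_const Real.pi
  refine HasDerivAt.congr_deriv (f := ntkG)
    ((hlin.mul harccos).add (hsqrt.const_mul (1 / (2 * Real.pi)))) ?_
  have hpi := Real.pi_ne_zero
  simp only [hroot, id, Function.comp, Pi.sub_apply, Pi.pow_apply]
  field_simp
  push_cast
  ring

theorem deriv_ntkG_two_add_sqrt_three_pos : 0 < deriv ntkG (2 + Real.sqrt 3) := by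
  have h3 : Real.sqrt 3 ^ 2 = 3 := Real.sq_sqrt (by norm_num)
  have hl : 1.7 < Real.sqrt 3 := Real.lt_sqrt_of_sq_lt (by norm_num)
  have hu : Real.sqrt 3 < 2 := (Real.sqrt_lt' (by norm_num)).2 (by norm_num)
  have hpi := Real.pi_pos
  have hpi4 := Real.pi_le_four
  rw [(hasDerivAt_ntkG ⟨by linarith, by linarith⟩).deriv,
    show 4 * (2 + Real.sqrt 3) - (2 + Real.sqrt 3) ^ 2 = 1 by linear_combination -h3,
    show (2 + Real.sqrt 3) / 2 - 1 = Real.cos (Real.pi / 6) by rw [Real.cos_pi_div_six]; ring,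
    Real.arccos_cos (by positivity) (by linarith), Real.sqrt_one,
    show (2 + Real.sqrt 3 - 2) / (2 * Real.pi * 1) - Real.pi / 6 / Real.pi
      = (3 * Real.sqrt 3 - Real.pi) / (6 * Real.pi) by field_simp; ring]
  exact div_pos (by linarith) (by positivity)

/-- There exists `x ∈ (0, 4)` with `g′(x) > 0`; in particular `g` is not
completely monotone on `(0, 4)`. -/
theorem stmt_9 :
    (∃ x ∈ Set.Ioo (0 : ℝ) 4, 0 < deriv ntkG x) ∧
    ¬ (∀ (r : ℕ) (x : ℝ), x ∈ Set.Ioo (0 : ℝ) 4 →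
        0 ≤ (-1 : ℝ) ^ r * iteratedDeriv r ntkG x) := by
  have hmem : 2 + Real.sqrt 3 ∈ Set.Ioo (0 : ℝ) 4 :=
    ⟨by positivity, by
      linarith [(Real.sqrt_lt' (x := 3) (y := 2) (by norm_num)).2 (by norm_num)]⟩
  have hpos := deriv_ntkG_two_add_sqrt_three_pos
  refine ⟨⟨_, hmem, hpos⟩, fun h => ?_⟩
  have h1 := h 1 _ hmem
  rw [iteratedDeriv_one, pow_one] at h1
  linarith
end

section
/- Define K₀ : [0, ∞) → ℝ by K₀(z) = (1/π) · arccos(z²/2 − 1) for 0 ≤ z ≤ 2 and K₀(z) = 0 for z > 2 (the zero-order arc-cosine kernel profile on ℓ₂-normalized data). Then the radial function obtained from K₀ fails to be positive definite: there exist a dimension d ≥ 1, an integer n ≥ 1, points x₁, …, xₙ ∈ ℝ^d, and real coefficients c₁, …, cₙ such that ∑_{i=1}^n ∑_{j=1}^n cᵢ cⱼ K₀(‖xᵢ − xⱼ‖₂) < 0. -/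
/-- The zero-order arc-cosine kernel profile on ℓ₂-normalized data, extended by `0`
beyond `z = 2`. -/
noncomputable def arcCosProfile0 (z : ℝ) : ℝ :=
  if z ≤ 2 then (1 / Real.pi) * Real.arccos (z ^ 2 / 2 - 1) else 0

theorem arcCosProfile0_zero : arcCosProfile0 0 = 1 := by
  have : (0 : ℝ) ^ 2 / 2 - 1 = -1 := by norm_num
  rw [arcCosProfile0, if_pos (by norm_num), this, Real.arccos_neg_one]
  field_simp

theorem arcCosProfile0_of_two_le {z : ℝ} (hz : 2 ≤ z) : arcCosProfile0 z = 0 := by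
  rcases hz.eq_or_lt with rfl | hz
  · have : (2 : ℝ) ^ 2 / 2 - 1 = 1 := by norm_num
    rw [arcCosProfile0, if_pos le_rfl, this, Real.arccos_one, mul_zero]
  · exact if_neg hz.not_ge

theorem arcCosProfile0_sqrt_three : arcCosProfile0 (√3) = 1 / 3 := by
  have h : √3 ^ 2 / 2 - 1 = Real.cos (Real.pi / 3) := by
    rw [Real.sq_sqrt (by norm_num), Real.cos_pi_div_three]; norm_num
  have h2 : √3 ≤ 2 := by rw [Real.sqrt_le_left (by norm_num)]; norm_num
  rw [arcCosProfile0, if_pos h2, h,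
    Real.arccos_cos (by positivity) (by linarith [Real.pi_pos])]
  field_simp

theorem five_sixths_lt_arcCosProfile0 : 5 / 6 < arcCosProfile0 (2 - √3) := by
  have hsq : √3 ^ 2 = 3 := Real.sq_sqrt (by norm_num)
  have h0 : 0 ≤ √3 := Real.sqrt_nonneg 3
  have hcos : Real.cos (5 * Real.pi / 6) = -(√3 / 2) := by
    rw [← Real.cos_pi_div_six, ← Real.cos_pi_sub]; ring_nf
  have harc : 5 * Real.pi / 6 < Real.arccos ((2 - √3) ^ 2 / 2 - 1) := by
    rw [← Real.arccos_cos (x := 5 * Real.pi / 6) (by positivity) (by linarith [Real.pi_pos]), hcos]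
    refine Real.strictAntiOn_arccos ⟨?_, ?_⟩ ⟨?_, ?_⟩ ?_ <;> nlinarith
  rw [arcCosProfile0, if_pos (by linarith), one_div_mul_eq_div, lt_div_iff₀ Real.pi_pos]
  linarith

/-- The radial function obtained from the zero-order arc-cosine kernel
profile fails to be positive definite. -/
theorem stmt_10 :
    ∃ (d n : ℕ) (_ : 1 ≤ d) (_ : 1 ≤ n)
      (x : Fin n → EuclideanSpace ℝ (Fin d)) (c : Fin n → ℝ),
      ∑ i, ∑ j, c i * c j * arcCosProfile0 ‖x i - x j‖ < 0 := by
  have h2 : √3 ≤ 2 := by rw [Real.sqrt_le_left (by norm_num)]; norm_num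
  have hnorm (a b : ℝ) : ‖(!₂[a] : EuclideanSpace ℝ (Fin 1)) - !₂[b]‖ = |a - b| := by
    simp [EuclideanSpace.norm_eq, Real.sqrt_sq_eq_abs]
  -- Two copies, at distance `2`, of a difference with the small step `2 - √3`.
  refine ⟨1, 4, le_rfl, by norm_num,
    fun i => !₂[(![0, 2 - √3, 2, 4 - √3] : Fin 4 → ℝ) i], ![1, -1, 1, -1], ?_⟩
  have swap (a b : ℝ) : arcCosProfile0 |a - b| = arcCosProfile0 |b - a| := by rw [abs_sub_comm]
  have e01 : |2 - √3 - 0| = 2 - √3 := by rw [sub_zero, abs_of_nonneg (by linarith)]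
  have e02 : |(2 : ℝ) - 0| = 2 := by norm_num
  have e03 : arcCosProfile0 |4 - √3 - 0| = 0 :=
    arcCosProfile0_of_two_le (le_abs.2 (Or.inl (by linarith)))
  have e12 : |2 - (2 - √3)| = √3 := by rw [sub_sub_cancel, abs_of_nonneg (Real.sqrt_nonneg 3)]
  have e13 : |4 - √3 - (2 - √3)| = 2 := by ring_nf; norm_num
  have e23 : |4 - √3 - 2| = 2 - √3 := by
    rw [abs_of_nonneg (by linarith)]; ring
  simp only [hnorm, Fin.sum_univ_four, Matrix.cons_val, sub_self, abs_zero]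
  rw [swap 0 (2 - √3), swap 0 2, swap 0 (4 - √3), swap (2 - √3) 2, swap (2 - √3) (4 - √3),
    swap 2 (4 - √3), e01, e02, e03, e12, e13, e23, arcCosProfile0_zero,
    arcCosProfile0_of_two_le le_rfl, arcCosProfile0_sqrt_three]
  linarith [five_sixths_lt_arcCosProfile0]
end

section
/- Define K₁ : [0, ∞) → ℝ by K₁(z) = (1/π) · [ (1 − z²/2)(π − arccos(1 − z²/2)) + (z/2) √(4 − z²) ] for 0 ≤ z ≤ 2 and K₁(z) = 0 for z > 2 (the first-order arc-cosine kernel profile on ℓ₂-normalized data). Then the radial function obtained from K₁ fails to be positive definite: there exist a dimension d ≥ 1, an integer n ≥ 1, points x₁, …, xₙ ∈ ℝ^d, and real coefficients c₁, …, cₙ such that ∑_{i=1}^n ∑_{j=1}^n cᵢ cⱼ K₁(‖xᵢ − xⱼ‖₂) < 0. -/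
/-- The first-order arc-cosine kernel profile on ℓ₂-normalized data, extended by `0`
beyond `z = 2`. -/
noncomputable def arcCosProfile1 (z : ℝ) : ℝ :=
  if z ≤ 2 then
    (1 / Real.pi) * ((1 - z ^ 2 / 2) * (Real.pi - Real.arccos (1 - z ^ 2 / 2))
      + (z / 2) * Real.sqrt (4 - z ^ 2))
  else 0

theorem arcCosProfile1_zero : arcCosProfile1 0 = 1 := by
  simp [arcCosProfile1, Real.pi_ne_zero]

theorem arcCosProfile1_sqrt_two : arcCosProfile1 (Real.sqrt 2) = 1 / Real.pi := by
  have h : Real.sqrt 2 ≤ 2 := by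
    rw [Real.sqrt_le_left (by norm_num)]; norm_num
  have h2 : (4 - 2 : ℝ) = 2 := by norm_num
  simp [arcCosProfile1, h, h2, div_mul_eq_mul_div]

theorem arcCosProfile1_two : arcCosProfile1 2 = 0 := by
  have h : (1 - 2 ^ 2 / 2 : ℝ) = -1 := by norm_num
  have h' : (4 - 2 ^ 2 : ℝ) = 0 := by norm_num
  simp [arcCosProfile1, h, h']

/-- The origin followed by `√2` times the standard basis vectors: the origin is at distance `√2`
from every other point, and the other points are at mutual distance `2`. -/
noncomputable def starPoints (d : ℕ) : Fin (d + 1) → EuclideanSpace ℝ (Fin d) :=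
  Fin.cons 0 fun i => EuclideanSpace.single i (Real.sqrt 2)

theorem arcCosProfile1_starPoints_succ_succ {d : ℕ} (i j : Fin d) :
    arcCosProfile1 ‖starPoints d i.succ - starPoints d j.succ‖ = if i = j then 1 else 0 := by
  split_ifs with h
  · simp [h, arcCosProfile1_zero]
  · rw [← dist_eq_norm, starPoints, Fin.cons_succ, Fin.cons_succ, EuclideanSpace.dist_eq]
    have hs : ∑ k, dist ((EuclideanSpace.single i (Real.sqrt 2) : EuclideanSpace ℝ (Fin d)) k)
        ((EuclideanSpace.single j (Real.sqrt 2) : EuclideanSpace ℝ (Fin d)) k) ^ 2 = 2 ^ 2 := by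
      rw [Fintype.sum_eq_add i j h]
      · simp [h, Ne.symm h, Real.dist_eq]
        norm_num
      · rintro k ⟨hi, hj⟩
        simp [hi, hj]
    rw [hs, Real.sqrt_sq (by norm_num), arcCosProfile1_two]

/-- The radial function obtained from the first-order arc-cosine kernel
profile fails to be positive definite. -/
theorem stmt_11 :
    ∃ (d n : ℕ) (_ : 1 ≤ d) (_ : 1 ≤ n)
      (x : Fin n → EuclideanSpace ℝ (Fin d)) (c : Fin n → ℝ),
      ∑ i, ∑ j, c i * c j * arcCosProfile1 ‖x i - x j‖ < 0 := by
  refine ⟨10, 11, by norm_num, by norm_num, starPoints 10, Fin.cons (-3) fun _ => 1, ?_⟩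
  have h0 (j : Fin 10) : arcCosProfile1 ‖starPoints 10 0 - starPoints 10 j.succ‖
      = 1 / Real.pi := by
    simp [starPoints, abs_of_nonneg, arcCosProfile1_sqrt_two]
  have h1 (i : Fin 10) : arcCosProfile1 ‖starPoints 10 i.succ - starPoints 10 0‖
      = 1 / Real.pi := by
    rw [norm_sub_rev, h0]
  have hpi : 19 / 60 < 1 / Real.pi := by
    rw [lt_div_iff₀ Real.pi_pos]
    linarith [Real.pi_lt_d2]
  simp only [Fin.sum_univ_succ (n := 10), Fin.cons_zero, Fin.cons_succ, h0, h1,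
    arcCosProfile1_starPoints_succ_succ, sub_self, norm_zero, arcCosProfile1_zero,
    Finset.sum_add_distrib, Finset.sum_const, Finset.card_univ, Fintype.card_fin, nsmul_eq_mul,
    mul_ite, mul_one, mul_zero, Finset.sum_ite_eq, Finset.mem_univ, if_true]
  push_cast
  linarith
end
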